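/- Let θ₁, θ₂ and θ'₁ be extended configurations such that θ₁ → θ₂, where → is either →grow or one of the ε-transitions, and θ'₁ ⪯ θ₁. Then there exists an extended configuration θ'₂ such that θ'₂ ⪯ θ₂ and θ'₁ reaches θ'₂ by a sequence of at most 4·2^{|𝒮|} + 1 transition steps of the transition system (each step an ε-, inc- or grow-transition). -/

import Mathlib

namespace ECBUDA

/-- Evaluation of a nonempty word under the semigroup homomorphism determined
by the letter map `h` (and `none` on the empty word). -/
def hword {A B S : Type} [Mul S] (h : A × B → S) : List (A × B) → Option S
  | [] => none
  | c :: w => some (w.foldl (fun s x => s * h x) (h c))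

/-- (NF1): the homomorphism takes distinct values on words of length one:
`h(w) = h(c)` iff `w = c`. -/
def NF1 {A B S : Type} [Mul S] (h : A × B → S) : Prop :=
  ∀ (w : List (A × B)) (c : A × B), hword h w = some (h c) ↔ w = [c]

/-- Basic tests allowed in normal form (NF2): state tests, `⟨μ⟩^=`, `⟨μ⟩^≠`
and `root`. -/
inductive NTest (Q S : Type) : Type where
  | state : Q → NTest Q S
  | deq : S → NTest Q S
  | dneq : S → NTest Q S
  | root : NTest Q S

/-- Basic actions. -/
inductive NAct (Q : Type) : Type where
  | accept : NAct Q
  | keep : Q → NAct Q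
  | store : Q → NAct Q
  | guess : Q → NAct Q
  | univ : Q → NAct Q

/-- The set `TA`: possibly negated basic tests (the Boolean flag `true` marks
negation), basic actions, and the three symbols `⊤`, `⊤g`, `⊥`. -/
inductive TA (Q S : Type) : Type where
  | test : Bool → NTest Q S → TA Q S
  | act : NAct Q → TA Q S
  | top : TA Q S
  | topg : TA Q S
  | bot : TA Q S

/-- A transition of the automaton in normal form: a conjunction of possibly
negated basic tests with a conjunction of basic actions. -/
abbrev NTrans (Q S : Type) : Type := List (Bool × NTest Q S) × List (NAct Q)

/-- An extended configuration `(Δ, Γ, r, m)`: `Δ` a finite set of threads,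
`Γ` a finite set of pairs (semigroup element, data value) containing exactly
one pair whose first component is the image under `h` of a letter (this letter
is the label of the configuration and the associated data value its data
value), and Booleans `r` (root) and `m` (merge). -/
structure EConf (A B Q S : Type) (D : Type) (h : A × B → S) : Type where
  Δ : Set (Q × TA Q S × D)
  Γ : Set (S × D)
  r : Bool
  m : Bool
  finΔ : Δ.Finite
  finΓ : Γ.Finite
  uniq : ∃! x : S × D, x ∈ Γ ∧ ∃ c : A × B, x.1 = h c

variable {A B Q S D : Type} {h : A × B → S}

/-- `Δ(d)`: the threads carrying the data value `d`. -/
def EConf.dfun (θ : EConf A B Q S D h) (d : D) : Set (Q × TA Q S) :=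
  {qa | (qa.1, qa.2, d) ∈ θ.Δ}

/-- `Γ(d)`: the semigroup elements of downward paths leading to `d`. -/
def EConf.gfun (θ : EConf A B Q S D h) (d : D) : Set S :=
  {μ | (μ, d) ∈ θ.Γ}

/-- The data values occurring in the extended configuration. -/
def EConf.dataset (θ : EConf A B Q S D h) : Set D :=
  {d | (∃ qa : Q × TA Q S, (qa.1, qa.2, d) ∈ θ.Δ) ∨ ∃ μ : S, (μ, d) ∈ θ.Γ}

/-- The unique pair of `Γ` recording the label and the data value of the root. -/
def EConf.rootInfo (θ : EConf A B Q S D h) : Set (S × D) :=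
  {x ∈ θ.Γ | ∃ c : A × B, x.1 = h c}

/-- The set of data values of the root pair (a singleton). -/
def EConf.rootData (θ : EConf A B Q S D h) : Set D :=
  {d | ∃ μ : S, (μ, d) ∈ θ.Γ ∧ ∃ c : A × B, μ = h c}

/-- The profile `(A₀, A₁, r, m)` of an extended configuration: `Aᵢ` is the set
of those `χ ⊆ S` such that exactly `i` data values `d` satisfy `Γ(d) = χ`. -/
def EConf.profile (θ : EConf A B Q S D h) :
    Set (Set S) × Set (Set S) × Bool × Bool :=
  ({χ | {d | θ.gfun d = χ}.encard = 0},
   {χ | {d | θ.gfun d = χ}.encard = 1}, θ.r, θ.m)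

/-- `θ₁ ⪯_f θ₂`. -/
def pleF (f : D → D) (θ₁ θ₂ : EConf A B Q S D h) : Prop :=
  θ₁.profile = θ₂.profile ∧ θ₁.dataset ⊆ Set.range f ∧
  ∀ d : D, θ₁.dfun (f d) ⊆ θ₂.dfun d ∧ θ₁.gfun (f d) = θ₂.gfun d

/-- The well-quasi-order `⪯` on extended configurations. -/
def ple (θ₁ θ₂ : EConf A B Q S D h) : Prop :=
  ∃ f : D → D, pleF f θ₁ θ₂

/-- `θ₁ ∼ θ₂`: equal up to a bijection of the data values. -/
def simEquiv (θ₁ θ₂ : EConf A B Q S D h) : Prop :=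
  ∃ g : D ≃ D,
    θ₂.Δ = {x | (x.1, x.2.1, g.symm x.2.2) ∈ θ₁.Δ} ∧
    θ₂.Γ = {x | (x.1, g.symm x.2) ∈ θ₁.Γ} ∧
    θ₂.r = θ₁.r ∧ θ₂.m = θ₁.m

/-- The closure of a set of extended configurations under `∼`. -/
def simClose (Θ : Set (EConf A B Q S D h)) : Set (EConf A B Q S D h) :=
  {θ | ∃ θ' ∈ Θ, simEquiv θ θ'}

/-- `Θ ≤min Θ'`: every member of `Θ'` is minorized by a member of `Θ`. -/
def leMin (Θ Θ' : Set (EConf A B Q S D h)) : Prop :=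
  ∀ θ' ∈ Θ', ∃ θ ∈ Θ, ple θ θ'

/-- Satisfaction of a basic test by the thread `(q, d)` in an extended
configuration. -/
def ntestHolds (θ : EConf A B Q S D h) (q : Q) (d : D) : NTest Q S → Prop
  | .state p => q = p
  | .deq μ => (μ, d) ∈ θ.Γ
  | .dneq μ => ∃ e : D, e ≠ d ∧ (μ, e) ∈ θ.Γ
  | .root => θ.r = true

def taTestHolds (θ : EConf A B Q S D h) (q : Q) (d : D) (neg : Bool)
    (t : NTest Q S) : Prop :=
  if neg then ¬ ntestHolds θ q d t else ntestHolds θ q d t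

/-- The tests and actions occurring in a transition, as elements of `TA`. -/
def taSet (tr : NTrans Q S) : Set (TA Q S) :=
  {x | (∃ nt ∈ tr.1, x = TA.test nt.1 nt.2) ∨ ∃ a ∈ tr.2, x = TA.act a}

/-- The ε-transitions of the transition system: they keep `Γ`, `r` (hence the
label and data value), require the merge flag to be false, and rewrite one
thread of `Δ`. -/
def epsStep (δ : List (NTrans Q S)) (θ₁ θ₂ : EConf A B Q S D h) : Prop :=
  θ₁.m = false ∧ θ₂.m = false ∧ θ₂.r = θ₁.r ∧ θ₂.Γ = θ₁.Γ ∧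
  ∃ (q : Q) (d : D),
    -- applying a transition of δ to a ⊥-thread
    ((∃ tr ∈ δ, (q, TA.bot, d) ∈ θ₁.Δ ∧
        θ₂.Δ = (θ₁.Δ \ {(q, TA.bot, d)}) ∪
          {x | x.1 = q ∧ x.2.2 = d ∧ x.2.1 ∈ taSet tr}) ∨
    -- univ
    (∃ p : Q, (q, TA.act (NAct.univ p), d) ∈ θ₁.Δ ∧
        θ₂.Δ = (θ₁.Δ \ {(q, TA.act (NAct.univ p), d)}) ∪
          {x | x.1 = p ∧ x.2.1 = TA.top ∧ ∃ μ : S, (μ, x.2.2) ∈ θ₁.Γ}) ∨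
    -- guess
    (∃ (p : Q) (d' : D), (q, TA.act (NAct.guess p), d) ∈ θ₁.Δ ∧
        θ₂.Δ = (θ₁.Δ \ {(q, TA.act (NAct.guess p), d)}) ∪ {(p, TA.topg, d')}) ∨
    -- store
    (∃ (p : Q) (d' : D), (q, TA.act (NAct.store p), d) ∈ θ₁.Δ ∧
        d' ∈ θ₁.rootData ∧
        θ₂.Δ = (θ₁.Δ \ {(q, TA.act (NAct.store p), d)}) ∪ {(p, TA.top, d')}) ∨
    -- keep
    (∃ p : Q, (q, TA.act (NAct.keep p), d) ∈ θ₁.Δ ∧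
        θ₂.Δ = (θ₁.Δ \ {(q, TA.act (NAct.keep p), d)}) ∪ {(p, TA.top, d)}) ∨
    -- accept
    ((q, TA.act NAct.accept, d) ∈ θ₁.Δ ∧
        θ₂.Δ = θ₁.Δ \ {(q, TA.act NAct.accept, d)}) ∨
    -- a (possibly negated) basic test, deleted if it holds
    (∃ (neg : Bool) (t : NTest Q S), (q, TA.test neg t, d) ∈ θ₁.Δ ∧
        taTestHolds θ₁ q d neg t ∧
        θ₂.Δ = θ₁.Δ \ {(q, TA.test neg t, d)}))

/-- The transition `→inc(S, χ)`. -/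
def incStep (Sq : Set (Q × TA Q S)) (χ : Set S) (θ₁ θ₂ : EConf A B Q S D h) :
    Prop :=
  (∃ d : D, θ₁.dfun d = Sq ∧ θ₁.gfun d = χ) ∧
  (∃ e₁ e₂ : D, e₁ ≠ e₂ ∧ θ₁.gfun e₁ = χ ∧ θ₁.gfun e₂ = χ) ∧
  ∃ e : D, e ∉ θ₁.dataset ∧ θ₂.r = θ₁.r ∧ θ₂.m = θ₁.m ∧
    (∀ d : D, d ≠ e → θ₂.dfun d = θ₁.dfun d ∧ θ₂.gfun d = θ₁.gfun d) ∧
    θ₂.dfun e = {qa ∈ Sq | qa.2 ≠ TA.topg} ∧ θ₂.gfun e = χ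

/-- The transition `→inc`. -/
def inc (θ₁ θ₂ : EConf A B Q S D h) : Prop :=
  ∃ (Sq : Set (Q × TA Q S)) (χ : Set S), incStep Sq χ θ₁ θ₂

/-- The transition `→grow`, adding a new root on top. -/
def growStep [Semigroup S] (θ₁ θ₂ : EConf A B Q S D h) : Prop :=
  θ₁.r = false ∧ θ₁.m = false ∧
  (∀ x ∈ θ₁.Δ, x.2.1 = TA.top ∨ x.2.1 = TA.topg) ∧
  θ₂.Δ = {x | x.2.1 = TA.bot ∧ ∃ α : TA Q S, (x.1, α, x.2.2) ∈ θ₁.Δ} ∧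
  ∃ (c : A × B) (d' : D),
    θ₂.Γ = {y | ∃ μ : S, ∃ e : D, (μ, e) ∈ θ₁.Γ ∧ y = (h c * μ, e)} ∪ {(h c, d')}

/-- The transition `→merge`, merging two extended configurations with the same
label and data value. -/
def mergeStep (θ₁ θ₂ θ₀ : EConf A B Q S D h) : Prop :=
  θ₁.rootInfo = θ₂.rootInfo ∧ θ₀.rootInfo = θ₁.rootInfo ∧
  θ₁.m = true ∧ θ₂.m = true ∧ θ₀.r = θ₁.r ∧ θ₁.r = θ₂.r ∧
  θ₀.Δ = θ₁.Δ ∪ θ₂.Δ ∧ θ₀.Γ = θ₁.Γ ∪ θ₂.Γ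

/-- Any single (ε-, inc- or grow-) transition step of the transition system. -/
def anyStep [Semigroup S] (δ : List (NTrans Q S)) (θ₁ θ₂ : EConf A B Q S D h) :
    Prop :=
  epsStep δ θ₁ θ₂ ∨ inc θ₁ θ₂ ∨ growStep θ₁ θ₂

/-- `Θ ⟹ θ`: one derivation step from a set of extended configurations. -/
def stepFrom [Semigroup S] (δ : List (NTrans Q S))
    (Θ : Set (EConf A B Q S D h)) (θ : EConf A B Q S D h) : Prop :=
  (∃ θ₁ ∈ Θ, anyStep δ θ₁ θ) ∨ ∃ θ₁ ∈ Θ, ∃ θ₂ ∈ Θ, mergeStep θ₁ θ₂ θ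

/-- `Θ ⟹⁺ θ`. -/
inductive Derives [Semigroup S] (δ : List (NTrans Q S)) :
    Set (EConf A B Q S D h) → EConf A B Q S D h → Prop where
  | base {Θ : Set (EConf A B Q S D h)} {θ : EConf A B Q S D h} :
      stepFrom δ Θ θ → Derives δ Θ θ
  | step {Θ : Set (EConf A B Q S D h)} {θ' θ : EConf A B Q S D h} :
      stepFrom δ Θ θ' → Derives δ (Θ ∪ {θ'}) θ → Derives δ Θ θ

/-- `Θ ⟹ⁿ θ`: derivation in at most `n` steps. -/
inductive DerivesN [Semigroup S] (δ : List (NTrans Q S)) :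
    ℕ → Set (EConf A B Q S D h) → EConf A B Q S D h → Prop where
  | base {n : ℕ} {Θ : Set (EConf A B Q S D h)} {θ : EConf A B Q S D h} :
      stepFrom δ Θ θ → DerivesN δ (n + 1) Θ θ
  | step {n : ℕ} {Θ : Set (EConf A B Q S D h)} {θ' θ : EConf A B Q S D h} :
      stepFrom δ Θ θ' → DerivesN δ n (Θ ∪ {θ'}) θ → DerivesN δ (n + 1) Θ θ

/-- `n`-fold composition of a binary relation. -/
def relPow {α : Type} (R : α → α → Prop) : ℕ → α → α → Prop
  | 0 => Eq
  | n + 1 => fun a c => ∃ b, R a b ∧ relPow R n b c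

/-- An initial extended configuration (abstracting a leaf). -/
def Initial (q0 : Q) (θ : EConf A B Q S D h) : Prop :=
  (∃ d : D, θ.Δ = {(q0, TA.bot, d)}) ∧
  ∃ (c : A × B) (d' : D), θ.Γ = {(h c, d')}

/-- An accepting extended configuration: no remaining threads. -/
def Accepting (θ : EConf A B Q S D h) : Prop := θ.Δ = ∅

def InjAt (f : D → D) (d : D) : Prop := ∀ x, f x = f d → x = d

theorem exists_two {θ' θ : EConf A B Q S D h} {f : D → D} (hf : pleF f θ' θ)
    {x₁ x₂ : D} (hne : x₁ ≠ x₂) (he : θ.gfun x₁ = θ.gfun x₂) :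
    ∃ z₁ z₂ : D, z₁ ≠ z₂ ∧ θ'.gfun z₁ = θ.gfun x₁ ∧ θ'.gfun z₂ = θ.gfun x₁ := by
  obtain ⟨hp, -, hg⟩ := hf
  have h1 : θ'.profile.2.1 = θ.profile.2.1 := by rw [hp]
  by_contra hcon
  push Not at hcon
  have hm : θ.gfun x₁ ∈ θ'.profile.2.1 := by
    change Set.encard _ = 1
    rw [Set.encard_eq_one]
    refine ⟨f x₁, Set.eq_singleton_iff_unique_mem.2 ⟨(hg x₁).2, fun y hy => ?_⟩⟩
    by_contra hy'
    exact hcon y (f x₁) hy' hy (hg x₁).2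
  rw [h1] at hm
  change Set.encard _ = 1 at hm
  rw [Set.encard_eq_one] at hm
  obtain ⟨a, ha⟩ := hm
  have e1 : x₁ ∈ ({a} : Set D) := ha ▸ rfl
  have e2 : x₂ ∈ ({a} : Set D) := ha ▸ he.symm
  exact hne (e1.trans e2.symm)

theorem dataset_finite (θ : EConf A B Q S D h) : θ.dataset.Finite := by
  refine ((θ.finΔ.image (fun x => x.2.2)).union (θ.finΓ.image Prod.snd)).subset ?_
  rintro d (⟨qa, hq⟩ | ⟨μ, hμ⟩)
  · exact Or.inl ⟨_, hq, rfl⟩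
  · exact Or.inr ⟨_, hμ, rfl⟩

theorem gfun_empty_infinite [Infinite D] (θ : EConf A B Q S D h) :
    {d | θ.gfun d = ∅}.Infinite := by
  refine (dataset_finite θ).infinite_compl.mono ?_
  intro d hd
  refine Set.eq_empty_iff_forall_notMem.2 fun μ hμ => hd (Or.inr ⟨μ, hμ⟩)

theorem profile_of [Infinite D] {θ' θ : EConf A B Q S D h} {f : D → D}
    (hr : θ'.r = θ.r) (hm : θ'.m = θ.m) (hs : θ'.dataset ⊆ Set.range f)
    (hg : ∀ x, θ'.gfun (f x) = θ.gfun x)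
    (hP : ∀ x₁ x₂, x₁ ≠ x₂ → θ.gfun x₁ = θ.gfun x₂ → (θ.gfun x₁).Nonempty →
      ∃ z₁ z₂ : D, z₁ ≠ z₂ ∧ θ'.gfun z₁ = θ.gfun x₁ ∧ θ'.gfun z₂ = θ.gfun x₁) :
    θ'.profile = θ.profile := by
  have key : ∀ χ : Set S, ({d | θ'.gfun d = χ}.encard = 0 ↔ {d | θ.gfun d = χ}.encard = 0) ∧
      ({d | θ'.gfun d = χ}.encard = 1 ↔ {d | θ.gfun d = χ}.encard = 1) := by
    intro χ
    rcases Set.eq_empty_or_nonempty χ with rfl | hχ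
    · rw [(gfun_empty_infinite θ).encard_eq, (gfun_empty_infinite θ').encard_eq]
      simp
    · have hsur : ∀ z, θ'.gfun z = χ → ∃ x, f x = z ∧ θ.gfun x = χ := by
        intro z hz
        obtain ⟨μ, hμ⟩ := hχ
        rw [← hz] at hμ
        obtain ⟨x, rfl⟩ := hs (Or.inr ⟨μ, hμ⟩)
        exact ⟨x, rfl, (hg x) ▸ hz⟩
      constructor
      · rw [Set.encard_eq_zero, Set.encard_eq_zero, Set.eq_empty_iff_forall_notMem,
          Set.eq_empty_iff_forall_notMem]
        constructor
        · intro H x hx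
          exact H (f x) ((hg x).trans hx)
        · intro H z hz
          obtain ⟨x, -, hx⟩ := hsur z hz
          exact H x hx
      · rw [Set.encard_eq_one, Set.encard_eq_one]
        constructor
        · rintro ⟨a, ha⟩
          have haa : θ'.gfun a = χ := (ha ▸ rfl : a ∈ {d | θ'.gfun d = χ})
          obtain ⟨x, -, hx⟩ := hsur a haa
          refine ⟨x, Set.eq_singleton_iff_unique_mem.2 ⟨hx, fun y hy => ?_⟩⟩
          by_contra hne
          have hy' : θ.gfun y = χ := hy
          obtain ⟨z₁, z₂, h12, h1, h2⟩ := hP y x hne (hy'.trans hx.symm) (hy' ▸ hχ)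
          rw [hy'] at h1 h2
          have e1 : z₁ ∈ ({a} : Set D) := ha ▸ h1
          have e2 : z₂ ∈ ({a} : Set D) := ha ▸ h2
          exact h12 (e1.trans e2.symm)
        · rintro ⟨a, ha⟩
          have haa : θ.gfun a = χ := (ha ▸ rfl : a ∈ {d | θ.gfun d = χ})
          refine ⟨f a, Set.eq_singleton_iff_unique_mem.2 ⟨(hg a).trans haa, fun y hy => ?_⟩⟩
          obtain ⟨x, rfl, hx⟩ := hsur y hy
          have e1 : x ∈ ({a} : Set D) := ha ▸ hx
          rw [show x = a from e1]
  unfold EConf.profile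
  rw [hr, hm]
  congr 1
  · ext χ; exact (key χ).1
  · congr 1
    ext χ; exact (key χ).2

theorem relPow_add {α : Type} {R : α → α → Prop} : ∀ {m n : ℕ} {a b c : α},
    relPow R m a b → relPow R n b c → relPow R (m + n) a c
  | 0, n, a, b, c, h1, h2 => by
    cases h1
    simpa using h2
  | m + 1, n, a, b, c, h1, h2 => by
    obtain ⟨b', h3, h4⟩ := h1
    rw [Nat.add_right_comm]
    exact ⟨b', h3, relPow_add h4 h2⟩

theorem relPow_one {α : Type} {R : α → α → Prop} {a b : α} (hR : R a b) : relPow R 1 a b :=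
  ⟨b, hR, rfl⟩

open Classical in
theorem split [Finite S] [Semigroup S] [Infinite D] (δ : List (NTrans Q S))
    {θ' θ : EConf A B Q S D h} {f : D → D} (hf : pleF f θ' θ) (d z : D) :
    ∃ (θ'' : EConf A B Q S D h) (f' : D → D) (n : ℕ), n ≤ 1 ∧
      relPow (anyStep δ) n θ' θ'' ∧ pleF f' θ'' θ ∧ InjAt f' d ∧ f' d = f d ∧
      θ''.dfun (f d) = θ'.dfun (f d) ∧ θ''.dfun (f z) = θ'.dfun (f z) ∧
      (InjAt f z → InjAt f' z ∧ f' z = f z) := by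
  by_cases hd : InjAt f d
  · exact ⟨θ', f, 0, by omega, rfl, hf, hd, rfl, rfl, rfl, fun hz => ⟨hz, rfl⟩⟩
  unfold InjAt at hd
  push Not at hd
  obtain ⟨x₀, hx₀, hne⟩ := hd
  have hfin : (θ'.dataset ∪ {f d, f z}).Finite := (dataset_finite θ').union (by simp)
  obtain ⟨e, he⟩ := hfin.exists_notMem
  obtain ⟨y, hy⟩ := (hfin.union (Set.finite_singleton e)).exists_notMem
  simp only [Set.mem_union, Set.mem_insert_iff, Set.mem_singleton_iff, not_or] at he hy
  obtain ⟨he1, he2, he3⟩ := he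
  obtain ⟨⟨hy1, hy2, hy3⟩, hy4⟩ := hy
  obtain ⟨hp, hs, hg⟩ := id hf
  have hgx : θ.gfun x₀ = θ.gfun d := by rw [← (hg x₀).2, hx₀, (hg d).2]
  have hnoc : ∀ c, h c ∉ θ.gfun d := by
    intro c hc
    have hc' : h c ∈ θ.gfun x₀ := hgx ▸ hc
    have := θ.uniq.unique ⟨hc, c, rfl⟩ ⟨hc', c, rfl⟩
    exact hne (congrArg Prod.snd this).symm
  have hΔe : ∀ q α, (q, α, e) ∉ θ'.Δ := fun q α hh => he1 (Or.inl ⟨(q, α), hh⟩)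
  have hΓe : ∀ μ, (μ, e) ∉ θ'.Γ := fun μ hh => he1 (Or.inr ⟨μ, hh⟩)
  have hΔy : ∀ q α, (q, α, y) ∉ θ'.Δ := fun q α hh => hy1 (Or.inl ⟨(q, α), hh⟩)
  have hΓy : ∀ μ, (μ, y) ∉ θ'.Γ := fun μ hh => hy1 (Or.inr ⟨μ, hh⟩)
  let θ'' : EConf A B Q S D h :=
    { Δ := θ'.Δ ∪ {x | x.2.2 = e ∧ (x.1, x.2.1, f d) ∈ θ'.Δ ∧ x.2.1 ≠ TA.topg}
      Γ := θ'.Γ ∪ {x | x.2 = e ∧ x.1 ∈ θ.gfun d}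
      r := θ'.r
      m := θ'.m
      finΔ := by
        refine θ'.finΔ.union ((θ'.finΔ.image (fun x => (x.1, x.2.1, e))).subset ?_)
        rintro ⟨q, α, w⟩ ⟨rfl, h1, -⟩
        exact ⟨_, h1, rfl⟩
      finΓ := by
        refine θ'.finΓ.union (((Set.toFinite (θ.gfun d)).image (fun x => (x, e))).subset ?_)
        rintro ⟨μ, w⟩ ⟨rfl, h1⟩
        exact ⟨_, h1, rfl⟩
      uniq := by
        obtain ⟨x, ⟨hx1, hx2⟩, hx3⟩ := θ'.uniq
        refine ⟨x, ⟨Or.inl hx1, hx2⟩, ?_⟩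
        rintro w ⟨hw | hw, c, hc⟩
        · exact hx3 w ⟨hw, c, hc⟩
        · exact absurd (hc ▸ hw.2) (hnoc c) }
  have hdne : ∀ w, w ≠ e → θ''.dfun w = θ'.dfun w := by
    intro w hw
    ext ⟨q, α⟩
    simp [EConf.dfun, θ'', hw]
  have hgne : ∀ w, w ≠ e → θ''.gfun w = θ'.gfun w := by
    intro w hw
    ext μ
    simp [EConf.gfun, θ'', hw]
  have hde : θ''.dfun e = {qa ∈ θ'.dfun (f d) | qa.2 ≠ TA.topg} := by
    ext ⟨q, α⟩
    simp [EConf.dfun, θ'', hΔe]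
  have hge : θ''.gfun e = θ.gfun d := by
    ext μ
    simp [EConf.gfun, θ'', hΓe]
  have hinc : incStep (θ'.dfun (f d)) (θ.gfun d) θ' θ'' := by
    refine ⟨⟨f d, rfl, (hg d).2⟩, ?_, e, he1, rfl, rfl, fun w hw => ⟨hdne w hw, hgne w hw⟩,
      hde, hge⟩
    exact exists_two hf hne.symm hgx.symm
  let f' : D → D := fun x =>
    if x = d then f d else if f x = f d then e else if f x = e then y else f x
  have hf'd : f' d = f d := by simp [f']
  have hs' : θ''.dataset ⊆ Set.range f' := by
    intro w hw
    by_cases hwe : w = e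
    · exact ⟨x₀, by simp [f', hne, hx₀, hwe]⟩
    · have hw' : w ∈ θ'.dataset := by
        rcases hw with ⟨qa, h1⟩ | ⟨μ, h1⟩
        · have : qa ∈ θ''.dfun w := h1
          rw [hdne w hwe] at this
          exact Or.inl ⟨qa, this⟩
        · have : μ ∈ θ''.gfun w := h1
          rw [hgne w hwe] at this
          exact Or.inr ⟨μ, this⟩
      obtain ⟨x, rfl⟩ := hs hw'
      by_cases hxd : f x = f d
      · exact ⟨d, by rw [hf'd, hxd]⟩
      · have : x ≠ d := fun hh => hxd (by rw [hh])
        exact ⟨x, by simp [f', this, hxd, hwe]⟩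
  have hge0 : θ'.gfun e = ∅ := Set.eq_empty_iff_forall_notMem.2 hΓe
  have hgy0 : θ'.gfun y = ∅ := Set.eq_empty_iff_forall_notMem.2 hΓy
  have hdy0 : θ'.dfun y = ∅ := Set.eq_empty_iff_forall_notMem.2 fun x => hΔy x.1 x.2
  have hg' : ∀ x, θ''.dfun (f' x) ⊆ θ.dfun x ∧ θ''.gfun (f' x) = θ.gfun x := by
    intro x
    by_cases h1 : x = d
    · subst h1
      rw [hf'd, hdne _ (Ne.symm he2), hgne _ (Ne.symm he2)]
      exact hg x
    by_cases h2 : f x = f d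
    · have : f' x = e := by simp [f', h1, h2]
      rw [this, hde, hge]
      refine ⟨fun w hw => (hg x).1 (h2 ▸ hw.1), ?_⟩
      rw [← (hg x).2, h2, (hg d).2]
    by_cases h3 : f x = e
    · have : f' x = y := by simp [f', h1, h3, he2]
      rw [this, hdne _ hy4, hgne _ hy4, hgy0, hdy0]
      refine ⟨Set.empty_subset _, ?_⟩
      rw [← (hg x).2, h3, hge0]
    · have : f' x = f x := by simp [f', h1, h2, h3]
      rw [this, hdne _ h3, hgne _ h3]
      exact hg x
  refine ⟨θ'', f', 1, le_rfl, relPow_one (Or.inr (Or.inl ⟨_, _, hinc⟩)),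
    ⟨?_, hs', hg'⟩, ?_, hf'd, hdne _ (Ne.symm he2), hdne _ (Ne.symm he3), ?_⟩
  · have hr : θ'.r = θ.r := congrArg (fun p => p.2.2.1) hp
    have hm : θ'.m = θ.m := congrArg (fun p => p.2.2.2) hp
    refine profile_of hr hm hs' (fun x => (hg' x).2) ?_
    intro x₁ x₂ h12 h1 hn
    obtain ⟨z₁, z₂, hz, hz1, hz2⟩ := exists_two hf h12 h1
    have aux : ∀ w, θ'.gfun w = θ.gfun x₁ → w ≠ e := by
      rintro w hw rfl
      rw [← hw, hge0] at hn
      exact Set.not_nonempty_empty hn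
    exact ⟨z₁, z₂, hz, by rw [hgne _ (aux _ hz1), hz1], by rw [hgne _ (aux _ hz2), hz2]⟩
  · intro x hx
    rw [hf'd] at hx
    by_contra h1
    simp only [f', h1, if_false] at hx
    split_ifs at hx <;> grind
  · intro hz
    have hfz : f' z = f z := by
      simp only [f']
      split_ifs with h1 h2 h3
      · rw [h1]
      · exact absurd (hz d h2.symm).symm h1
      · exact absurd h3.symm he3
      · rfl
    refine ⟨fun x hx => ?_, hfz⟩
    rw [hfz] at hx
    simp only [f'] at hx
    split_ifs at hx with h1 h2 h3
    · rw [h1]; exact hz d hx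
    · exact absurd hx he3
    · exact absurd hx hy3
    · exact hz x hx

/-- Replace one thread by a finite set of threads. -/
def repl (θ : EConf A B Q S D h) (t : Q × TA Q S × D) (N : Set (Q × TA Q S × D))
    (hN : N.Finite) : EConf A B Q S D h :=
  { θ with
    Δ := (θ.Δ \ {t}) ∪ N
    finΔ := (θ.finΔ.subset Set.sdiff_subset).union hN }

theorem repl_ple {θ' θ θ₂ : EConf A B Q S D h} {f : D → D} (hf : pleF f θ' θ)
    {q : Q} {α : TA Q S} {d : D} (hd : InjAt f d) {N N' : Set (Q × TA Q S × D)}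
    (hN' : N'.Finite) (hr : θ₂.r = θ.r) (hm : θ₂.m = θ.m) (hΓ : θ₂.Γ = θ.Γ)
    (hΔ : θ₂.Δ = (θ.Δ \ {(q, α, d)}) ∪ N)
    (hN : ∀ p β x, (p, β, f x) ∈ N' → (p, β, x) ∈ N)
    (hNr : ∀ p β w, (p, β, w) ∈ N' → w ∈ Set.range f) :
    ple (repl θ' (q, α, f d) N' hN') θ₂ := by
  obtain ⟨hp, hs, hg⟩ := hf
  have hgf : θ₂.gfun = θ.gfun := by funext x; simp [EConf.gfun, hΓ]
  refine ⟨f, ?_, ?_, ?_⟩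
  · have : θ₂.profile = θ.profile := by simp [EConf.profile, hgf, hr, hm]
    rw [this, ← hp]
    rfl
  · rintro w (⟨⟨p, β⟩, (h1 | h1)⟩ | ⟨μ, h1⟩)
    · exact hs (Or.inl ⟨(p, β), h1.1⟩)
    · exact hNr _ _ _ h1
    · exact hs (Or.inr ⟨μ, h1⟩)
  · intro x
    refine ⟨?_, by rw [hgf]; exact (hg x).2⟩
    rintro ⟨p, β⟩ (h1 | h1)
    · change _ ∈ θ₂.Δ
      rw [hΔ]
      refine Or.inl ⟨(hg x).1 h1.1, ?_⟩
      intro h2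
      apply h1.2
      simp only [Set.mem_singleton_iff, Prod.mk.injEq] at h2 ⊢
      exact ⟨h2.1, h2.2.1, by rw [h2.2.2]⟩
    · change _ ∈ θ₂.Δ
      rw [hΔ]
      exact Or.inr (hN _ _ _ h1)

theorem ple_of_missing {θ' θ θ₂ : EConf A B Q S D h} {f : D → D} (hf : pleF f θ' θ)
    {q : Q} {α : TA Q S} {d : D}
    (hr : θ₂.r = θ.r) (hm : θ₂.m = θ.m) (hΓ : θ₂.Γ = θ.Γ)
    (hΔ : θ.Δ \ {(q, α, d)} ⊆ θ₂.Δ) (hmiss : (q, α, f d) ∉ θ'.Δ) :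
    ple θ' θ₂ := by
  obtain ⟨hp, hs, hg⟩ := hf
  have hgf : θ₂.gfun = θ.gfun := by funext x; simp [EConf.gfun, hΓ]
  refine ⟨f, ?_, hs, fun x => ⟨?_, by rw [hgf]; exact (hg x).2⟩⟩
  · rw [hp]; simp [EConf.profile, hgf, hr, hm]
  · rintro ⟨p, β⟩ h1
    refine hΔ ⟨(hg x).1 h1, ?_⟩
    intro h2
    simp only [Set.mem_singleton_iff, Prod.mk.injEq] at h2
    obtain ⟨rfl, rfl, rfl⟩ := h2
    exact hmiss h1

theorem taSet_finite (tr : NTrans Q S) : (taSet tr).Finite := by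
  refine ((tr.1.finite_toSet.image (fun nt => TA.test nt.1 nt.2)).union
    (tr.2.finite_toSet.image TA.act)).subset ?_
  rintro x (⟨nt, h1, rfl⟩ | ⟨a, h1, rfl⟩)
  · exact Or.inl ⟨nt, h1, rfl⟩
  · exact Or.inr ⟨a, h1, rfl⟩

theorem ntest_iff {θ' θ : EConf A B Q S D h} {f : D → D} (hf : pleF f θ' θ)
    {d : D} (hd : InjAt f d) (q : Q) (t : NTest Q S) :
    ntestHolds θ' q (f d) t ↔ ntestHolds θ q d t := by
  obtain ⟨hp, hs, hg⟩ := hf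
  have hg2 : ∀ μ x, (μ, f x) ∈ θ'.Γ ↔ (μ, x) ∈ θ.Γ := fun μ x =>
    Set.ext_iff.1 (hg x).2 μ
  have hr : θ'.r = θ.r := congrArg (fun p => p.2.2.1) hp
  cases t with
  | state p => exact Iff.rfl
  | deq μ => exact hg2 μ d
  | root => simp [ntestHolds, hr]
  | dneq μ =>
    constructor
    · rintro ⟨w, h1, h2⟩
      obtain ⟨x, rfl⟩ := hs (Or.inr ⟨μ, h2⟩)
      exact ⟨x, fun hh => h1 (by rw [hh]), (hg2 μ x).1 h2⟩
    · rintro ⟨x, h1, h2⟩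
      exact ⟨f x, fun hh => h1 (hd x hh), (hg2 μ x).2 h2⟩

theorem eps_case [Finite S] [Semigroup S] [Infinite D] (δ : List (NTrans Q S))
    {θ₁ θ₂ θ'₁ : EConf A B Q S D h} (hstep : epsStep δ θ₁ θ₂) (hle : ple θ'₁ θ₁) :
    ∃ (θ'₂ : EConf A B Q S D h) (n : ℕ),
      ple θ'₂ θ₂ ∧ n ≤ 3 ∧ relPow (anyStep δ) n θ'₁ θ'₂ := by
  obtain ⟨hm1, hm2, hr, hΓ, q, d, hcases⟩ := hstep
  have hm : θ₂.m = θ₁.m := by rw [hm1, hm2]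
  -- generic treatment
  have main : ∀ (α : TA Q S) (N : Set (Q × TA Q S × D)) (z : D),
      θ₂.Δ = (θ₁.Δ \ {(q, α, d)}) ∪ N →
      (∀ (θ' : EConf A B Q S D h) (f : D → D), pleF f θ' θ₁ → InjAt f d → InjAt f z →
        (q, α, f d) ∈ θ'.Δ →
        ∃ (N' : Set (Q × TA Q S × D)) (hN' : N'.Finite),
          (∀ p β x, (p, β, f x) ∈ N' → (p, β, x) ∈ N) ∧
          (∀ p β w, (p, β, w) ∈ N' → w ∈ Set.range f) ∧
          epsStep δ θ' (repl θ' (q, α, f d) N' hN')) →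
      ∃ (θ'₂ : EConf A B Q S D h) (n : ℕ),
        ple θ'₂ θ₂ ∧ n ≤ 3 ∧ relPow (anyStep δ) n θ'₁ θ'₂ := by
    intro α N z hΔ H
    obtain ⟨f, hf⟩ := hle
    by_cases hmem : (q, α, f d) ∈ θ'₁.Δ
    · obtain ⟨θa, fa, na, hna, hra, hfa, hia, hea, hda, -, -⟩ := split δ hf d d
      obtain ⟨θb, fb, nb, hnb, hrb, hfb, hib, heb, -, hdb, hib2⟩ := split δ hfa z d
      obtain ⟨hib3, hib4⟩ := hib2 hia
      have hmb : (q, α, fb d) ∈ θb.Δ := by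
        have h0 : (q, α) ∈ θ'₁.dfun (f d) := hmem
        rw [← hda, ← hea, ← hdb, ← hib4] at h0
        exact h0
      obtain ⟨N', hN', h1, h2, h3⟩ := H θb fb hfb hib3 hib hmb
      refine ⟨_, na + nb + 1, repl_ple hfb hib3 hN' hr hm hΓ hΔ h1 h2, by omega,
        relPow_add (relPow_add hra hrb) (relPow_one (Or.inl h3))⟩
    · exact ⟨θ'₁, 0, ple_of_missing hf hr hm hΓ (hΔ ▸ Set.subset_union_left) hmem,
        by omega, rfl⟩
  have hmf : ∀ (θ' : EConf A B Q S D h) (f : D → D), pleF f θ' θ₁ → θ'.m = false := by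
    intro θ' f hf
    rw [← hm1]
    exact congrArg (fun p => p.2.2.2) hf.1
  rcases hcases with ⟨tr, htr, -, hΔ⟩ | ⟨p, -, hΔ⟩ | ⟨p, d', -, hΔ⟩ | ⟨p, d', -, hd', hΔ⟩ |
    ⟨p, -, hΔ⟩ | ⟨-, hΔ⟩ | ⟨neg, t, -, ht, hΔ⟩
  · refine main _ _ d hΔ ?_
    intro θ' f hf hd _ hmem
    refine ⟨{x | x.1 = q ∧ x.2.2 = f d ∧ x.2.1 ∈ taSet tr}, ?_, ?_, ?_, ?_⟩
    · refine ((taSet_finite tr).image (fun β => (q, β, f d))).subset ?_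
      rintro ⟨a, b, c⟩ ⟨rfl, rfl, h1⟩
      exact ⟨b, h1, rfl⟩
    · rintro p β x ⟨h1, h2, h3⟩
      exact ⟨h1, hd x h2, h3⟩
    · rintro p β x ⟨h1, h2, h3⟩
      exact ⟨d, h2.symm⟩
    · exact ⟨hmf θ' f hf, hmf θ' f hf, rfl, rfl, q, f d, Or.inl ⟨tr, htr, hmem, rfl⟩⟩
  · refine main _ _ d hΔ ?_
    intro θ' f hf hd _ hmem
    have hg2 : ∀ μ x, (μ, f x) ∈ θ'.Γ ↔ (μ, x) ∈ θ₁.Γ := fun μ x =>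
      Set.ext_iff.1 (hf.2.2 x).2 μ
    refine ⟨{x | x.1 = p ∧ x.2.1 = TA.top ∧ ∃ μ : S, (μ, x.2.2) ∈ θ'.Γ}, ?_, ?_, ?_, ?_⟩
    · refine (θ'.finΓ.image (fun y => (p, TA.top, y.2))).subset ?_
      rintro ⟨a, b, c⟩ ⟨rfl, rfl, μ, h1⟩
      exact ⟨_, h1, rfl⟩
    · rintro p β x ⟨h1, h2, μ, h3⟩
      exact ⟨h1, h2, μ, (hg2 μ x).1 h3⟩
    · rintro p β x ⟨h1, h2, μ, h3⟩
      exact hf.2.1 (Or.inr ⟨μ, h3⟩)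
    · exact ⟨hmf θ' f hf, hmf θ' f hf, rfl, rfl, q, f d, Or.inr (Or.inl ⟨p, hmem, rfl⟩)⟩
  · refine main _ _ d' hΔ ?_
    intro θ' f hf hd hd2 hmem
    refine ⟨{(p, TA.topg, f d')}, Set.finite_singleton _, ?_, ?_, ?_⟩
    · rintro p' β x hx
      simp only [Set.mem_singleton_iff, Prod.mk.injEq] at hx ⊢
      exact ⟨hx.1, hx.2.1, hd2 x hx.2.2⟩
    · rintro p' β x hx
      simp only [Set.mem_singleton_iff, Prod.mk.injEq] at hx
      exact ⟨d', hx.2.2.symm⟩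
    · exact ⟨hmf θ' f hf, hmf θ' f hf, rfl, rfl, q, f d,
        Or.inr (Or.inr (Or.inl ⟨p, f d', hmem, rfl⟩))⟩
  · refine main _ _ d' hΔ ?_
    intro θ' f hf hd hd2 hmem
    have hg2 : ∀ μ x, (μ, f x) ∈ θ'.Γ ↔ (μ, x) ∈ θ₁.Γ := fun μ x =>
      Set.ext_iff.1 (hf.2.2 x).2 μ
    refine ⟨{(p, TA.top, f d')}, Set.finite_singleton _, ?_, ?_, ?_⟩
    · rintro p' β x hx
      simp only [Set.mem_singleton_iff, Prod.mk.injEq] at hx ⊢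
      exact ⟨hx.1, hx.2.1, hd2 x hx.2.2⟩
    · rintro p' β x hx
      simp only [Set.mem_singleton_iff, Prod.mk.injEq] at hx
      exact ⟨d', hx.2.2.symm⟩
    · obtain ⟨μ, h1, h2⟩ := hd'
      exact ⟨hmf θ' f hf, hmf θ' f hf, rfl, rfl, q, f d,
        Or.inr (Or.inr (Or.inr (Or.inl ⟨p, f d', hmem, ⟨μ, (hg2 μ d').2 h1, h2⟩, rfl⟩)))⟩
  · refine main _ _ d hΔ ?_
    intro θ' f hf hd hd2 hmem
    refine ⟨{(p, TA.top, f d)}, Set.finite_singleton _, ?_, ?_, ?_⟩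
    · rintro p' β x hx
      simp only [Set.mem_singleton_iff, Prod.mk.injEq] at hx ⊢
      exact ⟨hx.1, hx.2.1, hd2 x hx.2.2⟩
    · rintro p' β x hx
      simp only [Set.mem_singleton_iff, Prod.mk.injEq] at hx
      exact ⟨d, hx.2.2.symm⟩
    · exact ⟨hmf θ' f hf, hmf θ' f hf, rfl, rfl, q, f d,
        Or.inr (Or.inr (Or.inr (Or.inr (Or.inl ⟨p, hmem, rfl⟩))))⟩
  · refine main (TA.act NAct.accept) ∅ d (by rw [hΔ, Set.union_empty]) ?_
    intro θ' f hf hd hd2 hmem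
    refine ⟨∅, Set.finite_empty, fun _ _ _ hx => hx, fun _ _ _ hx => hx.elim, ?_⟩
    exact ⟨hmf θ' f hf, hmf θ' f hf, rfl, rfl, q, f d,
        Or.inr (Or.inr (Or.inr (Or.inr (Or.inr (Or.inl ⟨hmem, Set.union_empty _⟩)))))⟩
  · refine main (TA.test neg t) ∅ d (by rw [hΔ, Set.union_empty]) ?_
    intro θ' f hf hd hd2 hmem
    refine ⟨∅, Set.finite_empty, fun _ _ _ hx => hx, fun _ _ _ hx => hx.elim, ?_⟩
    refine ⟨hmf θ' f hf, hmf θ' f hf, rfl, rfl, q, f d,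
        Or.inr (Or.inr (Or.inr (Or.inr (Or.inr (Or.inr ⟨neg, t, hmem, ?_, Set.union_empty _⟩)))))⟩
    unfold taTestHolds at ht ⊢
    rw [ntest_iff hf hd]
    exact ht

theorem grow_case [Semigroup S] [Infinite D]
    {θ₁ θ₂ θ' : EConf A B Q S D h} {f : D → D} (hf : pleF f θ' θ₁)
    (h1 : θ₁.r = false) (h2 : θ₁.m = false)
    (h3 : ∀ x ∈ θ₁.Δ, x.2.1 = TA.top ∨ x.2.1 = TA.topg)
    (h4 : θ₂.Δ = {x | x.2.1 = TA.bot ∧ ∃ α : TA Q S, (x.1, α, x.2.2) ∈ θ₁.Δ})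
    {c : A × B} {d : D}
    (h5 : θ₂.Γ = {y | ∃ μ : S, ∃ e : D, (μ, e) ∈ θ₁.Γ ∧ y = (h c * μ, e)} ∪ {(h c, d)})
    (hd : InjAt f d)
    (hC : ∀ x₁ x₂, x₁ ≠ x₂ → x₁ ≠ d → x₂ ≠ d → θ₁.gfun x₁ = θ₁.gfun d →
      θ₁.gfun x₂ = θ₁.gfun d → ∃ z₁ z₂, z₁ ≠ z₂ ∧ z₁ ≠ f d ∧ z₂ ≠ f d ∧
        θ'.gfun z₁ = θ₁.gfun d ∧ θ'.gfun z₂ = θ₁.gfun d) :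
    ∃ θ'₂ : EConf A B Q S D h, ple θ'₂ θ₂ ∧ growStep θ' θ'₂ := by
  obtain ⟨hp, hs, hg⟩ := id hf
  have hg2 : ∀ μ x, (μ, f x) ∈ θ'.Γ ↔ (μ, x) ∈ θ₁.Γ := fun μ x =>
    Set.ext_iff.1 (hg x).2 μ
  have hΔ2 : ∀ q α x, (q, α, f x) ∈ θ'.Δ → (q, α, x) ∈ θ₁.Δ := fun q α x hx =>
    @(hg x).1 (q, α) hx
  have hr : θ'.r = θ₁.r := congrArg (fun p => p.2.2.1) hp
  have hm : θ'.m = θ₁.m := congrArg (fun p => p.2.2.2) hp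
  let θ'₂ : EConf A B Q S D h :=
    { Δ := {x | x.2.1 = TA.bot ∧ ∃ α : TA Q S, (x.1, α, x.2.2) ∈ θ'.Δ}
      Γ := {y | ∃ μ : S, ∃ e : D, (μ, e) ∈ θ'.Γ ∧ y = (h c * μ, e)} ∪ {(h c, f d)}
      r := θ₂.r
      m := θ₂.m
      finΔ := by
        refine (θ'.finΔ.image (fun x => (x.1, TA.bot, x.2.2))).subset ?_
        rintro ⟨q, β, w⟩ ⟨rfl, α, hα⟩
        exact ⟨_, hα, rfl⟩
      finΓ := by
        refine ((θ'.finΓ.image (fun x => (h c * x.1, x.2))).subset ?_).union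
          (Set.finite_singleton _)
        rintro _ ⟨μ, e, hμ, rfl⟩
        exact ⟨_, hμ, rfl⟩
      uniq := by
        refine ⟨(h c, f d), ⟨Or.inr rfl, c, rfl⟩, ?_⟩
        rintro _ ⟨⟨μ, e, hμ, rfl⟩ | hw, c', hc'⟩
        · obtain ⟨x, rfl⟩ := hs (Or.inr ⟨μ, hμ⟩)
          have m1 : (h c * μ, x) ∈ θ₂.Γ := by
            rw [h5]; exact Or.inl ⟨μ, x, (hg2 μ x).1 hμ, rfl⟩
          have m2 : (h c, d) ∈ θ₂.Γ := by
            rw [h5]; exact Or.inr rfl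
          have := θ₂.uniq.unique ⟨m1, c', hc'⟩ ⟨m2, c, rfl⟩
          simp only [Prod.mk.injEq] at this
          rw [this.1, this.2]
        · exact hw }
  have hg₂ : ∀ μ x, μ ∈ θ₂.gfun x ↔ (∃ ν ∈ θ₁.gfun x, μ = h c * ν) ∨ (μ = h c ∧ x = d) := by
    intro μ x
    change (μ, x) ∈ θ₂.Γ ↔ _
    rw [h5]
    constructor
    · rintro (⟨ν, e, hν, he⟩ | hw)
      · obtain ⟨rfl, rfl⟩ := Prod.mk.inj he
        exact Or.inl ⟨ν, hν, rfl⟩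
      · exact Or.inr (Prod.mk.inj hw)
    · rintro (⟨ν, hν, rfl⟩ | ⟨rfl, rfl⟩)
      · exact Or.inl ⟨ν, x, hν, rfl⟩
      · exact Or.inr rfl
  have hg₂' : ∀ μ w, μ ∈ θ'₂.gfun w ↔
      (∃ ν ∈ θ'.gfun w, μ = h c * ν) ∨ (μ = h c ∧ w = f d) := by
    intro μ x
    constructor
    · rintro (⟨ν, e, hν, he⟩ | hw)
      · obtain ⟨rfl, rfl⟩ := Prod.mk.inj he
        exact Or.inl ⟨ν, hν, rfl⟩
      · exact Or.inr (Prod.mk.inj hw)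
    · rintro (⟨ν, hν, rfl⟩ | ⟨rfl, rfl⟩)
      · exact Or.inl ⟨ν, x, hν, rfl⟩
      · exact Or.inr rfl
  have hG : ∀ x, θ'₂.gfun (f x) = θ₂.gfun x := by
    intro x
    ext μ
    rw [hg₂, hg₂', (hg x).2]
    exact or_congr Iff.rfl (and_congr Iff.rfl ⟨hd x, fun hh => by rw [hh]⟩)
  have hS : θ'₂.dataset ⊆ Set.range f := by
    rintro w (⟨qa, -, α, hα⟩ | ⟨μ, hμ⟩)
    · exact hs (Or.inl ⟨(qa.1, α), hα⟩)
    · rcases (hg₂' μ w).1 hμ with ⟨ν, hν, -⟩ | ⟨-, rfl⟩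
      · exact hs (Or.inr ⟨ν, hν⟩)
      · exact ⟨d, rfl⟩
  refine ⟨θ'₂, ⟨f, ?_, hS, fun x => ⟨?_, hG x⟩⟩, hr.trans h1, hm.trans h2, ?_, rfl, c, f d, rfl⟩
  · refine profile_of rfl rfl hS hG ?_
    intro x₁ x₂ hne he _
    by_cases hff : f x₁ = f x₂
    · have hx1 : x₁ ≠ d := by
        rintro rfl
        exact hne (hd x₂ hff.symm).symm
      have hx2 : x₂ ≠ d := by
        rintro rfl
        exact hne (hd x₁ hff)
      have hee : θ₁.gfun x₁ = θ₁.gfun x₂ := by rw [← (hg x₁).2, hff, (hg x₂).2]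
      obtain ⟨z₁, z₂, hz, hz1, hz2, hz3, hz4⟩ : ∃ z₁ z₂, z₁ ≠ z₂ ∧ z₁ ≠ f d ∧ z₂ ≠ f d ∧
          θ'.gfun z₁ = θ₁.gfun x₁ ∧ θ'.gfun z₂ = θ₁.gfun x₁ := by
        by_cases hxd : θ₁.gfun x₁ = θ₁.gfun d
        · rw [hxd]
          exact hC x₁ x₂ hne hx1 hx2 hxd (hee.symm.trans hxd)
        · obtain ⟨z₁, z₂, hz, hz1, hz2⟩ := exists_two hf hne hee
          refine ⟨z₁, z₂, hz, ?_, ?_, hz1, hz2⟩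
          · rintro rfl
            exact hxd (hz1.symm.trans (hg d).2)
          · rintro rfl
            exact hxd (hz2.symm.trans (hg d).2)
      have aux : ∀ w, w ≠ f d → θ'.gfun w = θ₁.gfun x₁ → θ'₂.gfun w = θ₂.gfun x₁ := by
        intro w hw hw'
        ext μ
        rw [hg₂, hg₂', hw']
        simp [hw, hx1]
      exact ⟨z₁, z₂, hz, aux _ hz1 hz3, aux _ hz2 hz4⟩
    · exact ⟨f x₁, f x₂, hff, hG x₁, (hG x₂).trans he.symm⟩
  · rintro ⟨q, β⟩ ⟨hb, α, hα⟩
    change _ ∈ θ₂.Δ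
    rw [h4]
    exact ⟨hb, α, hΔ2 _ _ _ hα⟩
  · rintro ⟨q, α, w⟩ hw
    obtain ⟨x, rfl⟩ := hs (Or.inl ⟨(q, α), hw⟩)
    exact h3 (q, α, x) (hΔ2 _ _ _ hw)

/-- **Monotonicity for grow- and ε-transitions (Lemma 3.10)**: if
`θ₁ → θ₂` by a grow- or ε-transition and `θ'₁ ⪯ θ₁`, then some `θ'₂ ⪯ θ₂` is
reachable from `θ'₁` by at most `4·2^{|S|} + 1` transition steps (each an
ε-, inc- or grow-step). -/
theorem monotonicity_grow_eps (A B Q S D : Type) [Fintype A] [Fintype B]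
    [Fintype Q] [Fintype S] [Semigroup S] [Infinite D] (h : A × B → S)
    (hNF1 : NF1 h) (δ : List (NTrans Q S))
    (θ₁ θ₂ θ'₁ : EConf A B Q S D h)
    (hstep : growStep θ₁ θ₂ ∨ epsStep δ θ₁ θ₂) (hle : ple θ'₁ θ₁) :
    ∃ (θ'₂ : EConf A B Q S D h) (n : ℕ),
      ple θ'₂ θ₂ ∧ n ≤ 4 * 2 ^ Fintype.card S + 1 ∧
      relPow (anyStep δ) n θ'₁ θ'₂ := by
  rcases hstep with hstep | hstep
  · obtain ⟨h1, h2, h3, h4, c, d, h5⟩ := hstep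
    obtain ⟨f, hf⟩ := hle
    have fin : ∀ (θ' : EConf A B Q S D h) (n : ℕ), n ≤ 2 → relPow (anyStep δ) n θ'₁ θ' →
        (∃ θ'₂ : EConf A B Q S D h, ple θ'₂ θ₂ ∧ growStep θ' θ'₂) →
        ∃ (θ'₂ : EConf A B Q S D h) (n : ℕ),
          ple θ'₂ θ₂ ∧ n ≤ 4 * 2 ^ Fintype.card S + 1 ∧
          relPow (anyStep δ) n θ'₁ θ'₂ := by
      rintro θ' n hn hr ⟨θ'₂, hp, hgr⟩
      have := Nat.one_le_two_pow (n := Fintype.card S)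
      exact ⟨θ'₂, n + 1, hp, by omega, relPow_add hr (relPow_one (Or.inr (Or.inr hgr)))⟩
    obtain ⟨θa, fa, na, hna, hra, hfa, hia, -⟩ := split δ hf d d
    by_cases hC : ∃ x₁ x₂, x₁ ≠ x₂ ∧ x₁ ≠ d ∧ x₂ ≠ d ∧ θ₁.gfun x₁ = θ₁.gfun d ∧
        θ₁.gfun x₂ = θ₁.gfun d
    · obtain ⟨x₁, x₂, h12, hx1, hx2, hx3, hx4⟩ := hC
      obtain ⟨θb, fb, nb, hnb, hrb, hfb, hib, -, -, -, hib2⟩ := split δ hfa x₁ d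
      obtain ⟨hib3, -⟩ := hib2 hia
      refine fin θb (na + nb) (by omega) (relPow_add hra hrb)
        (grow_case hfb h1 h2 h3 h4 h5 hib3 ?_)
      intros
      exact ⟨fb x₁, fb x₂, fun hh => h12 (hib x₂ hh.symm).symm, fun hh => hx1 (hib3 x₁ hh),
        fun hh => hx2 (hib3 x₂ hh), ((hfb.2.2 x₁).2).trans hx3, ((hfb.2.2 x₂).2).trans hx4⟩
    · refine fin θa na (by omega) hra (grow_case hfa h1 h2 h3 h4 h5 hia ?_)
      intro x₁ x₂ a1 a2 a3 a4 a5
      exact absurd ⟨x₁, x₂, a1, a2, a3, a4, a5⟩ hC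
  · obtain ⟨θ'₂, n, hp, hn, hr⟩ := eps_case δ hstep hle
    have := Nat.one_le_two_pow (n := Fintype.card S)
    exact ⟨θ'₂, n, hp, by omega, hr⟩

end ECBUDA
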